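/- Let P ⊆ ℝ^d be a d-dimensional rational polytope with F(P) ≠ ∅. Then the support S_F(P) of the Fine interior is a finite set, F(P) = {x ∈ ℝ^d : ⟨x, ν⟩ ≥ Min_P(ν) + 1 for all ν ∈ S_F(P)}, and the convex cone generated by S_F(P) (the set of all nonnegative linear combinations of elements of S_F(P)) is all of ℝ^d. -/

import Mathlib

open Set MeasureTheory

noncomputable section

/-- The real vector corresponding to an integer vector. -/
def intVec {d : ℕ} (ν : Fin d → ℤ) : Fin d → ℝ := fun i => (ν i : ℝ)

/-- The standard inner product on `ℝ^d`. -/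
def dotR {d : ℕ} (x y : Fin d → ℝ) : ℝ := ∑ i, x i * y i

/-- `Min_P(ν) = min_{x ∈ P} ⟨x, ν⟩`. -/
def MinP {d : ℕ} (P : Set (Fin d → ℝ)) (ν : Fin d → ℝ) : ℝ :=
  sInf ((fun x => dotR x ν) '' P)

/-- The set of lattice points of `ℝ^d`. -/
def latticePts (d : ℕ) : Set (Fin d → ℝ) := Set.range intVec

/-- The set of rational points of `ℝ^d`. -/
def ratPts (d : ℕ) : Set (Fin d → ℝ) := {x | ∀ i, ∃ q : ℚ, x i = (q : ℝ)}

/-- The Fine interior of `P`. -/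
def fineInt {d : ℕ} (P : Set (Fin d → ℝ)) : Set (Fin d → ℝ) :=
  {x | ∀ ν : Fin d → ℤ, ν ≠ 0 → MinP P (intVec ν) + 1 ≤ dotR x (intVec ν)}

/-- A lattice polytope: the convex hull of a finite set of lattice points. -/
def IsLatticePolytope {d : ℕ} (P : Set (Fin d → ℝ)) : Prop :=
  ∃ A : Finset (Fin d → ℝ), ↑A ⊆ latticePts d ∧ P = convexHull ℝ (A : Set (Fin d → ℝ))

/-- A rational polytope: the convex hull of a finite set of rational points. -/
def IsRatPolytope {d : ℕ} (P : Set (Fin d → ℝ)) : Prop :=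
  ∃ A : Finset (Fin d → ℝ), ↑A ⊆ ratPts d ∧ P = convexHull ℝ (A : Set (Fin d → ℝ))

/-- A subset of `ℝ^d` is full-dimensional if its affine span is everything. -/
def IsFullDim {d : ℕ} (P : Set (Fin d → ℝ)) : Prop := affineSpan ℝ P = ⊤

/-- `P` is F-hollow if its Fine interior is empty. -/
def FHollow {d : ℕ} (P : Set (Fin d → ℝ)) : Prop := fineInt P = ∅

/-- The dilation `λP = {λx : x ∈ P}`. -/
def dilate {d : ℕ} (lam : ℝ) (P : Set (Fin d → ℝ)) : Set (Fin d → ℝ) :=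
  (fun x => lam • x) '' P

/-- The minimal multiplier `μ(P)`. -/
def minMult {d : ℕ} (P : Set (Fin d → ℝ)) : ℝ :=
  sInf {lam : ℝ | 0 < lam ∧ (fineInt (dilate lam P)).Nonempty}

/-- Unimodular equivalence of subsets of `ℝ^d`. -/
def UnimodEquiv {d : ℕ} (P₁ P₂ : Set (Fin d → ℝ)) : Prop :=
  ∃ φ : (Fin d → ℝ) ≃ᵃ[ℝ] (Fin d → ℝ),
    φ '' latticePts d = latticePts d ∧ φ '' P₁ = P₂

/-- An affine map `ℝ^d → ℝ^k` inducing a surjection of lattices. -/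
def IsLatticeProj {d k : ℕ} (π : (Fin d → ℝ) →ᵃ[ℝ] (Fin k → ℝ)) : Prop :=
  π '' latticePts d = latticePts k

/-- A sporadic F-hollow lattice polytope: a full-dimensional F-hollow lattice
polytope admitting no lattice projection onto a lower-dimensional F-hollow
lattice polytope. -/
def IsSporadic {d : ℕ} (P : Set (Fin d → ℝ)) : Prop :=
  IsLatticePolytope P ∧ IsFullDim P ∧ FHollow P ∧
  ¬ ∃ (k : ℕ) (_ : 1 ≤ k) (_ : k ≤ d - 1) (π : (Fin d → ℝ) →ᵃ[ℝ] (Fin k → ℝ)),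
      IsLatticeProj π ∧ IsLatticePolytope (π '' P) ∧ IsFullDim (π '' P) ∧
      FHollow (π '' P)

/-- A weakly sporadic F-hollow lattice polytope: a full-dimensional F-hollow
lattice polytope `P` such that `F(μ(P)·P)` is a single point. -/
def IsWeaklySporadic {d : ℕ} (P : Set (Fin d → ℝ)) : Prop :=
  IsLatticePolytope P ∧ IsFullDim P ∧ FHollow P ∧
  ∃ p : Fin d → ℝ, fineInt (dilate (minMult P) P) = {p}

/-- The support `S_F(P)` of the Fine interior of `P`. -/
def suppF {d : ℕ} (P : Set (Fin d → ℝ)) : Set (Fin d → ℤ) :=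
  {ν | MinP (fineInt P) (intVec ν) = MinP P (intVec ν) + 1}

/-- The dimension of the affine span of a set. -/
def aDim {d : ℕ} (S : Set (Fin d → ℝ)) : ℕ :=
  Module.finrank ℝ (affineSpan ℝ S).direction

/-- Lebesgue volume of a subset of `ℝ^d`, as a real number. -/
def vol {d : ℕ} (S : Set (Fin d → ℝ)) : ℝ := (volume S).toReal

section FineInterior

open Filter Topology

variable {d : ℕ}

lemma dotR_add_left (x y a : Fin d → ℝ) : dotR (x + y) a = dotR x a + dotR y a :=
  add_dotProduct x y a

lemma dotR_sub_left (x y a : Fin d → ℝ) : dotR (x - y) a = dotR x a - dotR y a :=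
  sub_dotProduct x y a

lemma dotR_smul_left (c : ℝ) (x a : Fin d → ℝ) : dotR (c • x) a = c * dotR x a :=
  smul_dotProduct c x a

lemma dotR_sub_right (x a b : Fin d → ℝ) : dotR x (a - b) = dotR x a - dotR x b :=
  dotProduct_sub x a b

lemma dotR_smul_right (c : ℝ) (x a : Fin d → ℝ) : dotR x (c • a) = c * dotR x a :=
  dotProduct_smul c x a

lemma continuous_dotR : Continuous fun p : (Fin d → ℝ) × (Fin d → ℝ) => dotR p.1 p.2 := by
  unfold dotR
  fun_prop

lemma continuous_dotR_left (a : Fin d → ℝ) : Continuous fun x => dotR x a := by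
  unfold dotR
  fun_prop

lemma abs_dotR_le (x a : Fin d → ℝ) : |dotR x a| ≤ d * ‖x‖ * ‖a‖ := by
  have h : ∀ i ∈ (Finset.univ : Finset (Fin d)), |x i * a i| ≤ ‖x‖ * ‖a‖ := fun i _ => by
    rw [abs_mul]
    exact mul_le_mul (norm_le_pi_norm x i) (norm_le_pi_norm a i) (abs_nonneg _) (norm_nonneg _)
  calc |dotR x a| ≤ ∑ i, |x i * a i| := Finset.abs_sum_le_sum_abs _ _
    _ ≤ ∑ _i : Fin d, ‖x‖ * ‖a‖ := Finset.sum_le_sum h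
    _ = d * ‖x‖ * ‖a‖ := by simp [mul_assoc]

lemma MinP_le {K : Set (Fin d → ℝ)} (hK : IsCompact K) {x : Fin d → ℝ} (hx : x ∈ K)
    (a : Fin d → ℝ) : MinP K a ≤ dotR x a :=
  csInf_le (hK.image (continuous_dotR_left a)).bddBelow ⟨x, hx, rfl⟩

lemma exists_dotR_eq_MinP {K : Set (Fin d → ℝ)} (hK : IsCompact K) (hne : K.Nonempty)
    (a : Fin d → ℝ) : ∃ x ∈ K, dotR x a = MinP K a :=
  (hK.image (continuous_dotR_left a)).sInf_mem (hne.image _)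

lemma continuous_MinP {K : Set (Fin d → ℝ)} (hK : IsCompact K) : Continuous (MinP K) :=
  hK.continuous_sInf (f := fun a x => dotR x a) (continuous_dotR.comp continuous_swap)

lemma isClosed_fineInt (K : Set (Fin d → ℝ)) : IsClosed (fineInt K) := by
  simp only [fineInt, ofPred_forall]
  exact isClosed_iInter fun ν => isClosed_iInter fun _ =>
    isClosed_le continuous_const (continuous_dotR_left _)

lemma isCompact_fineInt (K : Set (Fin d → ℝ)) : IsCompact (fineInt K) := by
  refine isCompact_Icc.of_isClosed_subset (isClosed_fineInt K)
    (?_ : _ ⊆ Icc (fun i => MinP K (intVec (Pi.single i 1)) + 1)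
      (fun i => -(MinP K (intVec (-Pi.single i 1)) + 1)))
  intro x hx
  have single (i : Fin d) : dotR x (intVec (Pi.single i 1)) = x i := by
    simp [dotR, intVec, Pi.single_apply]
  have neg_single (i : Fin d) : dotR x (intVec (-Pi.single i 1)) = -x i := by
    simp [dotR, intVec, Pi.single_apply]
  refine ⟨fun i => ?_, fun i => ?_⟩
  · simpa only [single] using hx (Pi.single i 1) (by simp)
  · have := hx (-Pi.single i 1) (by simp)
    rw [neg_single] at this
    exact le_neg_of_le_neg this

/-- Simultaneous Diophantine approximation. -/
lemma exists_intVec_near_nsmul (a : Fin d → ℝ) {ε : ℝ} (hε : 0 < ε) :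
    ∃ (q : ℕ) (ν : Fin d → ℤ), 0 < q ∧ ‖(q : ℝ) • a - intVec ν‖ < ε := by
  let u : ℕ → Fin d → ℝ := fun n i => Int.fract (n * a i)
  have hu (n : ℕ) : u n ∈ Icc (0 : Fin d → ℝ) 1 :=
    ⟨fun i => Int.fract_nonneg _, fun i => (Int.fract_lt_one _).le⟩
  obtain ⟨l, -, φ, hφ, hl⟩ := isCompact_Icc.tendsto_subseq hu
  obtain ⟨N, hN⟩ := Metric.cauchySeq_iff.1 hl.cauchySeq ε hε
  have hlt : φ N < φ (N + 1) := hφ N.lt_succ_self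
  refine ⟨φ (N + 1) - φ N, fun i => ⌊φ (N + 1) * a i⌋ - ⌊φ N * a i⌋, Nat.sub_pos_of_lt hlt, ?_⟩
  convert hN (N + 1) (by simp) N le_rfl using 1
  rw [dist_eq_norm]
  congr 1
  ext i
  simp only [Pi.sub_apply, Pi.smul_apply, smul_eq_mul, intVec, Function.comp_apply, u, Int.fract,
    Nat.cast_sub hlt.le]
  push_cast
  ring

/-- A compact set lies strictly below each point of its Fine interior in every direction. -/
lemma MinP_lt_of_mem_fineInt {K : Set (Fin d → ℝ)} (hK : IsCompact K) (hne : K.Nonempty)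
    {x : Fin d → ℝ} (hx : x ∈ fineInt K) {a : Fin d → ℝ} (ha : ‖a‖ = 1) :
    MinP K a < dotR x a := by
  by_contra! hle
  obtain ⟨R, hR⟩ := (hK.image (f := fun y => y - x) (by fun_prop)).isBounded.exists_norm_le
  have hR0 : 0 ≤ R := by
    obtain ⟨y, hy⟩ := hne
    exact (norm_nonneg _).trans (hR _ ⟨y, hy, rfl⟩)
  have hD : 0 < d * R + 1 := by positivity
  obtain ⟨q, ν, hq, hν⟩ := exists_intVec_near_nsmul a (ε := 1 / (d * R + 1)) (by positivity)
  have hq1 : (1 : ℝ) ≤ q := by exact_mod_cast hq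
  have hν0 : ν ≠ 0 := by
    rintro rfl
    have h0 : intVec (0 : Fin d → ℤ) = 0 := by ext; simp [intVec]
    rw [h0, sub_zero, norm_smul, ha, mul_one, Real.norm_natCast] at hν
    have : 1 / (d * R + 1) ≤ 1 := div_le_one_of_le₀ (le_add_of_nonneg_left (by positivity)) hD.le
    linarith
  obtain ⟨y, hy, hymin⟩ := exists_dotR_eq_MinP hK hne (intVec ν)
  have hfine := hx ν hν0
  have hya : dotR x a ≤ dotR y a := hle.trans (MinP_le hK hy a)
  have hbound : d * ‖y - x‖ * ‖(q : ℝ) • a - intVec ν‖ < 1 := by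
    calc d * ‖y - x‖ * ‖(q : ℝ) • a - intVec ν‖
        ≤ (d * R) * (1 / (d * R + 1)) := by
          gcongr
          exact hR _ ⟨y, hy, rfl⟩
      _ < 1 := by rw [mul_one_div, div_lt_one hD]; linarith
  have herr := le_of_abs_le (abs_dotR_le (y - x) ((q : ℝ) • a - intVec ν))
  rw [dotR_sub_right, dotR_sub_left, dotR_sub_left, dotR_smul_right, dotR_smul_right] at herr
  nlinarith [mul_le_mul_of_nonneg_left hya (zero_le_one.trans hq1)]

lemma exists_pos_mul_norm_add_MinP_le {K : Set (Fin d → ℝ)} (hK : IsCompact K)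
    (hne : K.Nonempty) :
    ∃ δ > 0, ∀ x ∈ fineInt K, ∀ a, δ * ‖a‖ + MinP K a ≤ dotR x a := by
  obtain ⟨δ, hδ, h⟩ := ((isCompact_fineInt K).prod
    (isCompact_sphere (0 : Fin d → ℝ) 1)).exists_forall_le' (a := 0)
    (f := fun p => dotR p.1 p.2 - MinP K p.2)
    (continuous_dotR.sub ((continuous_MinP hK).comp continuous_snd)).continuousOn
    (fun p hp => sub_pos.2 (MinP_lt_of_mem_fineInt hK hne hp.1 (by simpa using hp.2)))
  refine ⟨δ, hδ, fun x hx a => ?_⟩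
  have hle {y : Fin d → ℝ} (hy : y ∈ K) := MinP_le hK hy a
  rcases eq_or_ne a 0 with rfl | ha
  · obtain ⟨y, hy⟩ := hne
    simpa [dotR] using hle hy
  have ha' : 0 < ‖a‖ := norm_pos_iff.2 ha
  let u : Fin d → ℝ := ‖a‖⁻¹ • a
  have hu : ‖a‖ • u = a := smul_inv_smul₀ ha'.ne' a
  have hu1 : ‖u‖ = 1 := by simp [u, norm_smul, ha'.ne']
  obtain ⟨y, hy, hyu⟩ := exists_dotR_eq_MinP hK hne u
  have h1 : δ ≤ dotR x u - MinP K u := h (x, u) ⟨hx, by simpa using hu1⟩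
  have h2 := hle hy
  rw [← hu, dotR_smul_right] at h2
  have h3 : dotR x a = ‖a‖ * dotR x u := by rw [← dotR_smul_right, hu]
  rw [hu] at h2
  rw [h3]
  nlinarith

lemma finite_norm_intVec_le (R : ℝ) : {ν : Fin d → ℤ | ‖intVec ν‖ ≤ R}.Finite := by
  refine (finite_Icc (fun _ => -⌈R⌉) (fun _ => ⌈R⌉)).subset fun ν hν => ?_
  have h (i : Fin d) : |ν i| ≤ ⌈R⌉ := by
    have : |(ν i : ℝ)| ≤ ⌈R⌉ := ((norm_le_pi_norm (intVec ν) i).trans hν).trans (Int.le_ceil R)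
    exact_mod_cast this
  exact ⟨fun i => (abs_le.1 (h i)).1, fun i => (abs_le.1 (h i)).2⟩

lemma ne_zero_of_mem_suppF {K : Set (Fin d → ℝ)} (hK : IsCompact K) (hne : K.Nonempty)
    (hF : (fineInt K).Nonempty) {ν : Fin d → ℤ} (hν : ν ∈ suppF K) : ν ≠ 0 := by
  rintro rfl
  obtain ⟨x, -, hx⟩ := exists_dotR_eq_MinP hK hne (intVec 0)
  obtain ⟨y, -, hy⟩ := exists_dotR_eq_MinP (isCompact_fineInt K) hF (intVec 0)
  have h : MinP (fineInt K) (intVec 0) = MinP K (intVec 0) + 1 := hν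
  rw [← hx, ← hy] at h
  simp [dotR, intVec] at h

lemma mem_suppF_of_dotR_eq {K : Set (Fin d → ℝ)} {x : Fin d → ℝ} (hx : x ∈ fineInt K)
    {ν : Fin d → ℤ} (hν : ν ≠ 0) (h : dotR x (intVec ν) = MinP K (intVec ν) + 1) :
    ν ∈ suppF K := by
  obtain ⟨y, hy, hmin⟩ := exists_dotR_eq_MinP (isCompact_fineInt K) ⟨x, hx⟩ (intVec ν)
  exact le_antisymm (h ▸ MinP_le (isCompact_fineInt K) hx _) (hmin ▸ hy ν hν)

lemma finite_suppF {K : Set (Fin d → ℝ)} (hK : IsCompact K) (hne : K.Nonempty)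
    (hF : (fineInt K).Nonempty) : (suppF K).Finite := by
  obtain ⟨δ, hδ, h⟩ := exists_pos_mul_norm_add_MinP_le hK hne
  refine (finite_norm_intVec_le (1 / δ)).subset fun ν hν => ?_
  obtain ⟨x, hx, hmin⟩ := exists_dotR_eq_MinP (isCompact_fineInt K) hF (intVec ν)
  have h1 : MinP (fineInt K) (intVec ν) = MinP K (intVec ν) + 1 := hν
  have h2 := h x hx (intVec ν)
  rw [mem_ofPred_eq, le_div_iff₀' hδ]
  linarith

lemma fineInt_eq_of_suppF {K : Set (Fin d → ℝ)} (hK : IsCompact K) (hne : K.Nonempty)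
    (hF : (fineInt K).Nonempty) :
    fineInt K = {x | ∀ ν ∈ suppF K, MinP K (intVec ν) + 1 ≤ dotR x (intVec ν)} := by
  refine Subset.antisymm (fun x hx ν hν => hx ν (ne_zero_of_mem_suppF hK hne hF hν)) fun y hy => ?_
  obtain ⟨x, hx⟩ := hF
  obtain ⟨δ, hδ, hgap⟩ := exists_pos_mul_norm_add_MinP_le hK hne
  let z : ℝ → Fin d → ℝ := fun t => x + t • (y - x)
  have hz : Continuous z := by fun_prop
  have hz_dot (t : ℝ) (a : Fin d → ℝ) : dotR (z t) a = dotR x a + t * (dotR y a - dotR x a) := by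
    simp only [z, dotR_add_left, dotR_smul_left, dotR_sub_left]
  have hIcc : Icc (0 : ℝ) 1 ⊆ z ⁻¹' fineInt K := by
    refine IsClosed.Icc_subset_of_forall_mem_nhdsWithin
      (((isClosed_fineInt K).preimage hz).inter isClosed_Icc) (by simpa [z] using hx) ?_
    rintro t ⟨ht, ht0, ht1⟩
    have hsmall : ∀ᶠ s in 𝓝[>] t, ∀ ν ∈ {ν : Fin d → ℤ | ‖intVec ν‖ ≤ 2 / δ}, ν ≠ 0 →
        MinP K (intVec ν) + 1 ≤ dotR (z s) (intVec ν) := by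
      refine (eventually_all_finite (finite_norm_intVec_le _)).2 fun ν _ => ?_
      by_cases hν : ν = 0
      · simp [hν]
      rcases (ht ν hν).eq_or_lt with heq | hlt
      · have hyν := hy ν (mem_suppF_of_dotR_eq ht hν heq.symm)
        filter_upwards [self_mem_nhdsWithin] with s hs _
        have hs' : t < s := hs
        rw [hz_dot] at heq ⊢
        have : 0 ≤ dotR y (intVec ν) - dotR x (intVec ν) := by nlinarith
        nlinarith
      · have hc : Continuous fun s => dotR (z s) (intVec ν) := (continuous_dotR_left _).comp hz
        filter_upwards [nhdsWithin_le_nhds (hc.continuousAt.eventually_const_lt hlt)] with s hs _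
        exact hs.le
    have hnear : ∀ᶠ s in 𝓝[>] t, d * ‖z t - z s‖ < δ / 2 := by
      have hc : Continuous fun s => d * ‖z t - z s‖ := by fun_prop
      exact nhdsWithin_le_nhds (hc.continuousAt.eventually_lt_const (by simpa using hδ))
    filter_upwards [hsmall, hnear] with s hs hs' ν hν
    by_cases hR : ‖intVec ν‖ ≤ 2 / δ
    · exact hs ν hR hν
    rw [not_le, div_lt_iff₀' hδ] at hR
    have h1 := hgap _ ht (intVec ν)
    have h2 := le_of_abs_le (abs_dotR_le (z t - z s) (intVec ν))
    rw [dotR_sub_left] at h2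
    have h3 := mul_le_mul_of_nonneg_right hs'.le (norm_nonneg (intVec ν))
    linarith
  simpa [z] using hIcc (right_mem_Icc.2 zero_le_one)

lemma eq_zero_of_nonneg_on_suppF {K : Set (Fin d → ℝ)} (hK : IsCompact K) (hne : K.Nonempty)
    (hF : (fineInt K).Nonempty) {f : (Fin d → ℝ) →ₗ[ℝ] ℝ}
    (hf : ∀ ν ∈ suppF K, 0 ≤ f (intVec ν)) : f = 0 := by
  let y : Fin d → ℝ := fun i => f (Pi.single i 1)
  have hy (a : Fin d → ℝ) : f a = dotR y a := by
    rw [f.pi_apply_eq_sum_univ a]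
    simp only [dotR, y, smul_eq_mul, mul_comm]
    congr! with i _ j
    simp [Pi.single_apply, eq_comm]
  obtain ⟨x, hx⟩ := hF
  have hray (t : ℝ) (ht : 0 ≤ t) : x + t • y ∈ fineInt K := by
    rw [fineInt_eq_of_suppF hK hne ⟨x, hx⟩]
    intro ν hν
    have h1 := hx ν (ne_zero_of_mem_suppF hK hne ⟨x, hx⟩ hν)
    have h2 := mul_nonneg ht (hf ν hν)
    rw [hy] at h2
    rw [dotR_add_left, dotR_smul_left]
    linarith
  obtain ⟨M, hM⟩ := (isCompact_fineInt K).isBounded.exists_norm_le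
  have hM0 : 0 ≤ M := (norm_nonneg _).trans (hM x hx)
  have hy0 : y = 0 := by
    by_contra hy0
    have hpos : 0 < ‖y‖ := norm_pos_iff.2 hy0
    have ht : 0 ≤ (2 * M + 1) / ‖y‖ := by positivity
    have h1 := norm_sub_le (x + ((2 * M + 1) / ‖y‖) • y) x
    rw [add_sub_cancel_left, norm_smul, Real.norm_of_nonneg ht, div_mul_cancel₀ _ hpos.ne'] at h1
    linarith [hM _ (hray _ ht), hM _ hx]
  ext i
  simpa [y] using congrFun hy0 i

/-- A finite family on which no nonzero functional is nonnegative generates the whole space as a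
convex cone. -/
lemma exists_nonneg_sum_smul_eq {ι E : Type*} [NormedAddCommGroup E] [NormedSpace ℝ E]
    [FiniteDimensional ℝ E] (s : Finset ι) (v : ι → E)
    (h : ∀ f : E →ₗ[ℝ] ℝ, (∀ i ∈ s, 0 ≤ f (v i)) → f = 0) (x : E) :
    ∃ c : ι → ℝ, (∀ i, 0 ≤ c i) ∧ x = ∑ i ∈ s, c i • v i := by
  classical
  let C : Set E := {x | ∃ c : ι → ℝ, (∀ i, 0 ≤ c i) ∧ x = ∑ i ∈ s, c i • v i}
  have hsmul {t : ℝ} (ht : 0 ≤ t) {x : E} (hx : x ∈ C) : t • x ∈ C := by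
    obtain ⟨c, hc, rfl⟩ := hx
    exact ⟨fun i => t * c i, fun i => mul_nonneg ht (hc i), by simp [Finset.smul_sum, mul_smul]⟩
  have hconv : Convex ℝ C := by
    rintro - ⟨b, hb, rfl⟩ - ⟨c, hc, rfl⟩ p q hp hq -
    refine ⟨fun i => p * b i + q * c i,
      fun i => add_nonneg (mul_nonneg hp (hb i)) (mul_nonneg hq (hc i)), ?_⟩
    simp [Finset.smul_sum, mul_smul, add_smul, Finset.sum_add_distrib]
  have hzero : (0 : E) ∈ C := ⟨0, by simp, by simp⟩
  have hv {i : ι} (hi : i ∈ s) : v i ∈ C :=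
    ⟨Pi.single i 1, fun j => by by_cases hj : j = i <;> simp [hj],
      by simp [Pi.single_apply, ite_smul, hi]⟩
  have hspan : Submodule.span ℝ C = ⊤ := by
    by_contra hlt
    obtain ⟨f, hf0, hf⟩ := Submodule.exists_le_ker_of_lt_top _ (lt_top_iff_ne_top.2 hlt)
    exact hf0 (h f fun i hi => (hf (Submodule.subset_span (hv hi))).ge)
  have hint : (interior C).Nonempty := by
    rw [hconv.interior_nonempty_iff_affineSpan_eq_top, ← insert_eq_of_mem hzero]
    apply SetLike.coe_injective
    rw [affineSpan_insert_zero, hspan]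
    simp
  by_contra hx
  obtain ⟨f, hf0, hf⟩ := geometric_hahn_banach_of_nonempty_interior_point hconv
    (x := x) (fun hmem => hx (interior_subset hmem : x ∈ C)) hint
  refine hf0 (neg_eq_zero.1 (ContinuousLinearMap.coe_injective
    (h (-f : E →L[ℝ] ℝ) fun i hi => neg_nonneg.2 ?_)))
  by_contra! hpos
  change 0 < f (v i) at hpos
  have hfx : 0 ≤ f x := by simpa using hf 0 hzero
  have hle := hf _ (hsmul (t := (f x + 1) / f (v i)) (by positivity) (hv hi))
  rw [map_smul, smul_eq_mul, div_mul_cancel₀ _ hpos.ne'] at hle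
  linarith

end FineInterior

/-- For a `d`-dimensional rational polytope with nonempty Fine
interior, the support `S_F(P)` is finite, its inequalities cut out `F(P)`, and
its nonnegative span is all of `ℝ^d`. -/
theorem suppF_properties (d : ℕ) (P : Set (Fin d → ℝ))
    (hP : IsRatPolytope P) (hfull : IsFullDim P) (hne : (fineInt P).Nonempty) :
    (suppF P).Finite ∧
    fineInt P = {x | ∀ ν ∈ suppF P, MinP P (intVec ν) + 1 ≤ dotR x (intVec ν)} ∧
    (∀ x : Fin d → ℝ, ∃ (s : Finset (Fin d → ℤ)) (c : (Fin d → ℤ) → ℝ),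
      ↑s ⊆ suppF P ∧ (∀ ν, 0 ≤ c ν) ∧ x = ∑ ν ∈ s, c ν • intVec ν) := by
  have hK : IsCompact P := by
    obtain ⟨A, -, rfl⟩ := hP
    exact A.finite_toSet.isCompact_convexHull ℝ
  have hPne : P.Nonempty := (affineSpan_nonempty ℝ).1 (by rw [hfull]; exact univ_nonempty)
  have hfin := finite_suppF hK hPne hne
  refine ⟨hfin, fineInt_eq_of_suppF hK hPne hne, fun x => ?_⟩
  obtain ⟨c, hc, hx⟩ := exists_nonneg_sum_smul_eq hfin.toFinset intVec
    (fun f hf => eq_zero_of_nonneg_on_suppF hK hPne hne fun ν hν => hf ν (by simpa using hν)) x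
  exact ⟨hfin.toFinset, c, by simp, hc, hx⟩
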